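/- (i) For every σ ∈ ℝ: E_n = B_n^σ E_{n−1} − E_{n−1} B_n^σ and F_n = B_n^σ F_{n−1} − q^{-2} F_{n−1} B_n^σ in U_q(g). (ii) The following commutation relations hold in U_q(g): E_{n−1} F_{n−1} = q^2 F_{n−1} E_{n−1}; E_{n−1} F_n = q^2 F_n E_{n−1}; E_n F_{n−1} = F_{n−1} E_n; and E_n F_n = q^2 F_n E_n + (q^{-2} − 1) F_{n−1} E_{n−1} C_n^{-2}. -/

import Mathlib

namespace QG

/-- Generators of the quantized universal enveloping algebra `U_q(gl(m))`:
`K i`, its inverse `Ki i`, and the Chevalley generators `E j` (the `x_j`)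
and `F j` (the `y_j`).  Indices are 1-based natural numbers; out-of-range
generators are forced to be `1` (resp. `0`) by the relations. -/
inductive Gen : Type where
  | K : ℕ → Gen
  | Ki : ℕ → Gen
  | E : ℕ → Gen
  | F : ℕ → Gen

abbrev FA := FreeAlgebra ℂ Gen

noncomputable def fK (i : ℕ) : FA := FreeAlgebra.ι ℂ (Gen.K i)
noncomputable def fKi (i : ℕ) : FA := FreeAlgebra.ι ℂ (Gen.Ki i)
noncomputable def fE (i : ℕ) : FA := FreeAlgebra.ι ℂ (Gen.E i)
noncomputable def fF (i : ℕ) : FA := FreeAlgebra.ι ℂ (Gen.F i)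

/-- Kronecker delta with values in `ℤ`. -/
def kd (i j : ℕ) : ℤ := if i = j then 1 else 0

/-- The defining relations of `U_q(gl(m))`. -/
inductive Rel (q : ℝ) (m : ℕ) : FA → FA → Prop
  | Kout : ∀ i, ¬(1 ≤ i ∧ i ≤ m) → Rel q m (fK i) 1
  | Kiout : ∀ i, ¬(1 ≤ i ∧ i ≤ m) → Rel q m (fKi i) 1
  | Eout : ∀ j, ¬(1 ≤ j ∧ j + 1 ≤ m) → Rel q m (fE j) 0
  | Fout : ∀ j, ¬(1 ≤ j ∧ j + 1 ≤ m) → Rel q m (fF j) 0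
  | KK : ∀ i j, Rel q m (fK i * fK j) (fK j * fK i)
  | KKi : ∀ i, Rel q m (fK i * fKi i) 1
  | KiK : ∀ i, Rel q m (fKi i * fK i) 1
  | KE : ∀ i j, 1 ≤ i → i ≤ m → 1 ≤ j → j + 1 ≤ m →
      Rel q m (fK i * fE j) (((q : ℂ) ^ (kd i j - kd i (j+1))) • (fE j * fK i))
  | KF : ∀ i j, 1 ≤ i → i ≤ m → 1 ≤ j → j + 1 ≤ m →
      Rel q m (fK i * fF j) (((q : ℂ) ^ (kd i (j+1) - kd i j)) • (fF j * fK i))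
  | EF : ∀ i j, 1 ≤ i → i + 1 ≤ m → 1 ≤ j → j + 1 ≤ m →
      Rel q m (fE i * fF j - fF j * fE i)
        (if i = j then ((q : ℂ) - (q : ℂ)⁻¹)⁻¹ • (fK i * fKi (i+1) - fKi i * fK (i+1)) else 0)
  | EE : ∀ i j, 1 ≤ i → i + 1 ≤ m → 1 ≤ j → j + 1 ≤ m → (i + 2 ≤ j ∨ j + 2 ≤ i) →
      Rel q m (fE i * fE j) (fE j * fE i)
  | FF : ∀ i j, 1 ≤ i → i + 1 ≤ m → 1 ≤ j → j + 1 ≤ m → (i + 2 ≤ j ∨ j + 2 ≤ i) →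
      Rel q m (fF i * fF j) (fF j * fF i)
  | Eserre : ∀ i j, 1 ≤ i → i + 1 ≤ m → 1 ≤ j → j + 1 ≤ m → (i + 1 = j ∨ j + 1 = i) →
      Rel q m (fE i ^ 2 * fE j - ((q : ℂ) + (q : ℂ)⁻¹) • (fE i * fE j * fE i) + fE j * fE i ^ 2) 0
  | Fserre : ∀ i j, 1 ≤ i → i + 1 ≤ m → 1 ≤ j → j + 1 ≤ m → (i + 1 = j ∨ j + 1 = i) →
      Rel q m (fF i ^ 2 * fF j - ((q : ℂ) + (q : ℂ)⁻¹) • (fF i * fF j * fF i) + fF j * fF i ^ 2) 0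

/-- The quantized universal enveloping algebra `U_q(gl(m))`. -/
abbrev Uq (q : ℝ) (m : ℕ) := RingQuot (Rel q m)

noncomputable def uK (q : ℝ) (m i : ℕ) : Uq q m := RingQuot.mkAlgHom ℂ (Rel q m) (fK i)
noncomputable def uKi (q : ℝ) (m i : ℕ) : Uq q m := RingQuot.mkAlgHom ℂ (Rel q m) (fKi i)
noncomputable def uE (q : ℝ) (m i : ℕ) : Uq q m := RingQuot.mkAlgHom ℂ (Rel q m) (fE i)
noncomputable def uF (q : ℝ) (m i : ℕ) : Uq q m := RingQuot.mkAlgHom ℂ (Rel q m) (fF i)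

/-- `C_i = K_i K_{2n+1-i}` in `U_q(gl(2n))`. -/
noncomputable def Cc (q : ℝ) (n i : ℕ) : Uq q (2*n) := uK q (2*n) i * uK q (2*n) (2*n+1-i)
/-- `C_i⁻¹ = K_i⁻¹ K_{2n+1-i}⁻¹` in `U_q(gl(2n))`. -/
noncomputable def Ccinv (q : ℝ) (n i : ℕ) : Uq q (2*n) := uKi q (2*n) i * uKi q (2*n) (2*n+1-i)
/-- `B_j = y_j K_{j+1}⁻¹ K_{2n-j}⁻¹ + K_j⁻¹ x_{2n-j} K_{2n-j}⁻¹` in `U_q(gl(2n))`. -/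
noncomputable def Bb (q : ℝ) (n j : ℕ) : Uq q (2*n) :=
  uF q (2*n) j * uKi q (2*n) (j+1) * uKi q (2*n) (2*n-j)
  + uKi q (2*n) j * uE q (2*n) (2*n-j) * uKi q (2*n) (2*n-j)
/-- `B_n^σ = y_n K_{n+1}⁻¹ K_n⁻¹ + K_n⁻¹ x_n K_n⁻¹ + ((q^{-σ}-q^{σ})/(q-q⁻¹)) K_n⁻²`. -/
noncomputable def Bs (q σ : ℝ) (n : ℕ) : Uq q (2*n) :=
  uF q (2*n) n * uKi q (2*n) (n+1) * uKi q (2*n) n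
  + uKi q (2*n) n * uE q (2*n) n * uKi q (2*n) n
  + (((q ^ (-σ) - q ^ σ) / (q - q⁻¹) : ℝ) : ℂ) • ((uKi q (2*n) n)^2)

/-- The generating set of the coideal subalgebra `𝒜_σ ⊆ U_q(gl(2n))`. -/
def ASet (q σ : ℝ) (n : ℕ) : Set (Uq q (2*n)) :=
  {z | (∃ i, 1 ≤ i ∧ i ≤ 2*n ∧ (z = Cc q n i ∨ z = Ccinv q n i)) ∨
       (∃ j, 1 ≤ j ∧ j + 1 ≤ 2*n ∧ j ≠ n ∧ z = Bb q n j) ∨ z = Bs q σ n}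

/-- Generators of the abstract algebra `𝒜`. -/
inductive AGen : Type where
  | g : ℕ → AGen
  | gi : ℕ → AGen
  | b : ℕ → AGen

abbrev AFA := FreeAlgebra ℂ AGen

noncomputable def fγ (i : ℕ) : AFA := FreeAlgebra.ι ℂ (AGen.g i)
noncomputable def fγi (i : ℕ) : AFA := FreeAlgebra.ι ℂ (AGen.gi i)
noncomputable def fβ (j : ℕ) : AFA := FreeAlgebra.ι ℂ (AGen.b j)

/-- `(ε_i + ε_{2n+1-i}, α_j)` where `α_j = ε_j - ε_{j+1}`. -/
def gex (n i j : ℕ) : ℤ := kd i j + kd (2*n+1-i) j - kd i (j+1) - kd (2*n+1-i) (j+1)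

/-- The defining relations of the algebra `𝒜`. -/
inductive ARel (q : ℝ) (n : ℕ) : AFA → AFA → Prop
  | gout : ∀ i, ¬(1 ≤ i ∧ i ≤ 2*n) → ARel q n (fγ i) 1
  | giout : ∀ i, ¬(1 ≤ i ∧ i ≤ 2*n) → ARel q n (fγi i) 1
  | bout : ∀ j, ¬(1 ≤ j ∧ j + 1 ≤ 2*n) → ARel q n (fβ j) 0
  | gg : ∀ i j, ARel q n (fγ i * fγ j) (fγ j * fγ i)
  | ggi : ∀ i, ARel q n (fγ i * fγi i) 1
  | gig : ∀ i, ARel q n (fγi i * fγ i) 1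
  | gsym : ∀ i, 1 ≤ i → i ≤ 2*n → ARel q n (fγ i) (fγ (2*n+1-i))
  | gb : ∀ i j, 1 ≤ i → i ≤ 2*n → 1 ≤ j → j + 1 ≤ 2*n →
      ARel q n (fγ i * fβ j) (((q : ℂ) ^ (-(gex n i j))) • (fβ j * fγ i))
  | bb : ∀ i j, 1 ≤ i → i + 1 ≤ 2*n → 1 ≤ j → j + 1 ≤ 2*n → (i + 2 ≤ j ∨ j + 2 ≤ i) →
      ARel q n (fβ i * fβ j - fβ j * fβ i)
        (if i + j = 2*n then ((q : ℂ) * ((q : ℂ) - (q : ℂ)⁻¹)⁻¹) • (fγi i ^ 2 - fγi (i+1) ^ 2)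
         else 0)
  | serre1 : ∀ i, 1 ≤ i → i + 2 ≤ 2*n →
      ARel q n
        ((q : ℂ)⁻¹ • (fβ i ^ 2 * fβ (i+1)) - ((q : ℂ) + (q : ℂ)⁻¹) • (fβ i * fβ (i+1) * fβ i)
          + (q : ℂ) • (fβ (i+1) * fβ i ^ 2))
        (if i = n then (q : ℂ) • (fβ (n+1) * fγi n ^ 2) else 0)
  | serre2 : ∀ i, 2 ≤ i → i + 1 ≤ 2*n →
      ARel q n
        ((q : ℂ) • (fβ i ^ 2 * fβ (i-1)) - ((q : ℂ) + (q : ℂ)⁻¹) • (fβ i * fβ (i-1) * fβ i)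
          + (q : ℂ)⁻¹ • (fβ (i-1) * fβ i ^ 2))
        (if i = n then (q : ℂ)⁻¹ • (fβ (n-1) * fγi n ^ 2) else 0)

/-- The abstract algebra `𝒜`. -/
abbrev Aalg (q : ℝ) (n : ℕ) := RingQuot (ARel q n)

noncomputable def aγ (q : ℝ) (n i : ℕ) : Aalg q n := RingQuot.mkAlgHom ℂ (ARel q n) (fγ i)
noncomputable def aγi (q : ℝ) (n i : ℕ) : Aalg q n := RingQuot.mkAlgHom ℂ (ARel q n) (fγi i)
noncomputable def aβ (q : ℝ) (n j : ℕ) : Aalg q n := RingQuot.mkAlgHom ℂ (ARel q n) (fβ j)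

end QG

namespace QG

/-- `x̃_j = K_{2n-j}⁻¹ x_j K_j⁻¹` in `U_q(gl(2n))`. -/
noncomputable def xt (q : ℝ) (n j : ℕ) : Uq q (2*n) :=
  uKi q (2*n) (2*n-j) * uE q (2*n) j * uKi q (2*n) j
/-- `ỹ_j = y_j K_{j+1}⁻¹ K_{2n-j}⁻¹` in `U_q(gl(2n))`. -/
noncomputable def yt (q : ℝ) (n j : ℕ) : Uq q (2*n) :=
  uF q (2*n) j * uKi q (2*n) (j+1) * uKi q (2*n) (2*n-j)

noncomputable def Enm1 (q : ℝ) (n : ℕ) : Uq q (2*n) := xt q n (n+1)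
noncomputable def En (q : ℝ) (n : ℕ) : Uq q (2*n) := xt q n n * xt q n (n+1) - xt q n (n+1) * xt q n n
noncomputable def Fnm1 (q : ℝ) (n : ℕ) : Uq q (2*n) := yt q n (n-1)
noncomputable def Fn (q : ℝ) (n : ℕ) : Uq q (2*n) :=
  yt q n n * yt q n (n-1) - ((q : ℂ) ^ (-2 : ℤ)) • (yt q n (n-1) * yt q n n)

end QG

namespace QG

theorem mul_mul_eq_of_mul_eq {A : Type*} [Semigroup A] {k x : A} (h : k * x = x * k) (r : A) :
    k * (x * r) = x * (k * r) := by
  rw [← mul_assoc, h, mul_assoc]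

section QCommute

variable {A : Type*} [Ring A] [Algebra ℂ A]

/-- If `k` and `x` commute up to `t`, then the inverse of `k` and `x` commute up to `t⁻¹`. -/
theorem inv_mul_eq_smul_of_mul_eq_smul {k l x : A} {t : ℂ} (ht : t ≠ 0)
    (hkl : k * l = 1) (hlk : l * k = 1) (h : k * x = t • (x * k)) :
    l * x = t⁻¹ • (x * l) := by
  have h1 : x * l = t • (l * x) := by
    calc x * l = l * (k * x) * l := by rw [← mul_assoc l k x, hlk, one_mul]
      _ = t • (l * x) := by
        rw [h, mul_smul_comm, smul_mul_assoc, mul_assoc l, mul_assoc x, hkl, mul_one]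
  rw [h1, smul_smul, inv_mul_cancel₀ ht, one_smul]

theorem mul_mul_eq_smul_of_mul_eq_smul {k x : A} {t : ℂ} (h : k * x = t • (x * k)) (r : A) :
    k * (x * r) = t • (x * (k * r)) := by
  rw [← mul_assoc, h, smul_mul_assoc, mul_assoc]

/-- If `t` is the factor for both `z w` and `w e`, then `w` commutes with `[e, z]`. -/
theorem commutator_mul_comm_of_smul {t : ℂ} (ht : t ≠ 0) {e z w : A}
    (hzw : z * w = t • (w * z)) (hwe : w * e = t • (e * w)) :
    (e * z - z * e) * w = w * (e * z - z * e) := by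
  have h1 : e * z * w = w * e * z := by
    rw [mul_assoc, hzw, hwe, mul_smul_comm, smul_mul_assoc, mul_assoc]
  have h2 : z * e * w = w * z * e := by
    have : t • (z * e * w) = t • (w * z * e) := by
      rw [mul_assoc, ← mul_smul_comm, ← hwe, ← mul_assoc, hzw, smul_mul_assoc]
    exact smul_right_injective A ht this
  rw [sub_mul, mul_sub, h1, h2, mul_assoc, mul_assoc]

/-- The commutation relation between the `q`-commutators `[e, z]` and `[f, w]_{q⁻²}`. -/
theorem commutator_mul_qCommutator {q : ℂ} (hq : q ≠ 0) {e z f w S : A}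
    (hzf : z * f = f * z) (hzw : z * w = q ^ 2 • (w * z)) (hwe : w * e = q ^ 2 • (e * w))
    (hSw : S * w = (q ^ 2)⁻¹ • (w * S))
    (hefz : (e * f - q ^ 2 • (f * e)) * z - z * (e * f - q ^ 2 • (f * e)) = -(z * S)) :
    (e * z - z * e) * (f * w - (q ^ 2)⁻¹ • (w * f)) =
      q ^ 2 • ((f * w - (q ^ 2)⁻¹ • (w * f)) * (e * z - z * e))
        + ((q ^ 2)⁻¹ - 1) • (w * z * S) := by
  have hq2 : q ^ 2 ≠ 0 := pow_ne_zero 2 hq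
  have hEw := commutator_mul_comm_of_smul hq2 hzw hwe
  have hEf : (e * z - z * e) * f = q ^ 2 • (f * (e * z - z * e)) - z * S := by
    have h1 : e * z * f = e * f * z := by rw [mul_assoc, hzf, mul_assoc]
    have h2 : f * (z * e) = z * (f * e) := by rw [← mul_assoc, ← hzf, mul_assoc]
    have h3 : (e * z - z * e) * f =
        ((e * f - q ^ 2 • (f * e)) * z - z * (e * f - q ^ 2 • (f * e)))
          + q ^ 2 • (f * (e * z - z * e)) := by
      rw [sub_mul, h1, mul_sub f, h2]
      simp only [sub_mul, mul_sub, smul_mul_assoc, mul_smul_comm, mul_assoc]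
      module
    rw [h3, hefz]; abel
  have hzSw : z * S * w = w * z * S := by
    rw [mul_assoc, hSw, mul_smul_comm, ← mul_assoc, hzw, smul_mul_assoc, smul_smul,
      inv_mul_cancel₀ hq2, one_smul]
  calc (e * z - z * e) * (f * w - (q ^ 2)⁻¹ • (w * f))
      = ((e * z - z * e) * f) * w - (q ^ 2)⁻¹ • (w * ((e * z - z * e) * f)) := by
        rw [mul_sub, mul_smul_comm, ← mul_assoc, ← mul_assoc _ w f, hEw, mul_assoc w]
    _ = q ^ 2 • (f * (w * (e * z - z * e))) - z * S * w
          - (q ^ 2)⁻¹ • (q ^ 2 • (w * (f * (e * z - z * e))) - w * z * S) := by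
        rw [hEf, sub_mul, smul_mul_assoc, mul_assoc f, hEw, mul_sub w (_ • _), mul_smul_comm,
          mul_assoc w z S]
    _ = _ := by
        rw [hzSw]
        simp only [sub_mul (f * w), smul_mul_assoc, mul_assoc]
        match_scalars <;> field_simp
        ring

end QCommute

section Relations

variable {q : ℝ} {m : ℕ}

theorem uK_mul_uKi (i : ℕ) : uK q m i * uKi q m i = 1 := by
  simpa only [uK, uKi, map_mul, map_one] using RingQuot.mkAlgHom_rel ℂ (Rel.KKi (q := q) (m := m) i)

theorem uKi_mul_uK (i : ℕ) : uKi q m i * uK q m i = 1 := by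
  simpa only [uK, uKi, map_mul, map_one] using RingQuot.mkAlgHom_rel ℂ (Rel.KiK (q := q) (m := m) i)

theorem uK_mul_uK (i j : ℕ) : uK q m i * uK q m j = uK q m j * uK q m i := by
  simpa only [uK, map_mul] using RingQuot.mkAlgHom_rel ℂ (Rel.KK (q := q) (m := m) i j)

theorem uKi_mul_uK_comm (i j : ℕ) : uKi q m i * uK q m j = uK q m j * uKi q m i := by
  simpa using inv_mul_eq_smul_of_mul_eq_smul (t := 1) one_ne_zero
    (uK_mul_uKi (q := q) (m := m) i) (uKi_mul_uK i) (by simpa using uK_mul_uK i j)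

theorem uKi_mul_uKi (i j : ℕ) : uKi q m i * uKi q m j = uKi q m j * uKi q m i := by
  simpa using inv_mul_eq_smul_of_mul_eq_smul (t := 1) one_ne_zero
    (uK_mul_uKi (q := q) (m := m) i) (uKi_mul_uK i) (by simpa using (uKi_mul_uK_comm j i).symm)

theorem uKi_mul_uE (hq : (q : ℂ) ≠ 0) {i j : ℕ} (hi : 1 ≤ i) (him : i ≤ m) (hj : 1 ≤ j)
    (hjm : j + 1 ≤ m) :
    uKi q m i * uE q m j = (q : ℂ) ^ (kd i (j + 1) - kd i j) • (uE q m j * uKi q m i) := by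
  have h := inv_mul_eq_smul_of_mul_eq_smul (zpow_ne_zero _ hq) (uK_mul_uKi (q := q) (m := m) i)
    (uKi_mul_uK i) (x := uE q m j) (by
      simpa only [uK, uE, map_mul, map_smul] using
        RingQuot.mkAlgHom_rel ℂ (Rel.KE (q := q) i j hi him hj hjm))
  rwa [← zpow_neg, neg_sub] at h

theorem uKi_mul_uF (hq : (q : ℂ) ≠ 0) {i j : ℕ} (hi : 1 ≤ i) (him : i ≤ m) (hj : 1 ≤ j)
    (hjm : j + 1 ≤ m) :
    uKi q m i * uF q m j = (q : ℂ) ^ (kd i j - kd i (j + 1)) • (uF q m j * uKi q m i) := by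
  have h := inv_mul_eq_smul_of_mul_eq_smul (zpow_ne_zero _ hq) (uK_mul_uKi (q := q) (m := m) i)
    (uKi_mul_uK i) (x := uF q m j) (by
      simpa only [uK, uF, map_mul, map_smul] using
        RingQuot.mkAlgHom_rel ℂ (Rel.KF (q := q) i j hi him hj hjm))
  rwa [← zpow_neg, neg_sub] at h

theorem uE_mul_uF_of_ne {i j : ℕ} (hi : 1 ≤ i) (him : i + 1 ≤ m) (hj : 1 ≤ j)
    (hjm : j + 1 ≤ m) (hij : i ≠ j) : uE q m i * uF q m j = uF q m j * uE q m i := by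
  have h := RingQuot.mkAlgHom_rel ℂ (Rel.EF (q := q) i j hi him hj hjm)
  rw [if_neg hij] at h
  simpa only [uE, uF, map_mul, map_sub, map_zero, sub_eq_zero] using h

theorem uE_mul_uF_self {i : ℕ} (hi : 1 ≤ i) (him : i + 1 ≤ m) :
    uE q m i * uF q m i = uF q m i * uE q m i +
      ((q : ℂ) - (q : ℂ)⁻¹)⁻¹ • (uK q m i * uKi q m (i + 1) - uKi q m i * uK q m (i + 1)) := by
  have h := RingQuot.mkAlgHom_rel ℂ (Rel.EF (q := q) i i hi him hi him)
  rw [if_pos rfl] at h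
  rw [← sub_eq_iff_eq_add']
  simpa only [uE, uF, uK, uKi, map_mul, map_sub, map_smul] using h

end Relations

end QG

open QG in
/-- (i) `E_n = B_n^σ E_{n-1} − E_{n-1} B_n^σ` and `F_n = B_n^σ F_{n-1} − q⁻² F_{n-1} B_n^σ`
for any `σ`; (ii) the commutation relations
`E_{n-1}F_{n-1} = q² F_{n-1}E_{n-1}`, `E_{n-1}F_n = q² F_n E_{n-1}`,
`E_n F_{n-1} = F_{n-1} E_n`, and
`E_n F_n = q² F_n E_n + (q⁻² − 1) F_{n-1} E_{n-1} C_n⁻²` hold in `U_q(gl(2n))`. -/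
theorem statement_14 (q : ℝ) (hq0 : 0 < q) (hq1 : q < 1) (n : ℕ) (hn : 2 ≤ n) :
    (∀ σ : ℝ,
      En q n = Bs q σ n * Enm1 q n - Enm1 q n * Bs q σ n ∧
      Fn q n = Bs q σ n * Fnm1 q n - ((q : ℂ) ^ (-2 : ℤ)) • (Fnm1 q n * Bs q σ n)) ∧
    Enm1 q n * Fnm1 q n = ((q : ℂ) ^ (2 : ℕ)) • (Fnm1 q n * Enm1 q n) ∧
    Enm1 q n * Fn q n = ((q : ℂ) ^ (2 : ℕ)) • (Fn q n * Enm1 q n) ∧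
    En q n * Fnm1 q n = Fnm1 q n * En q n ∧
    En q n * Fn q n = ((q : ℂ) ^ (2 : ℕ)) • (Fn q n * En q n)
      + (((q : ℂ) ^ (-2 : ℤ)) - 1) • (Fnm1 q n * Enm1 q n * (Ccinv q n n)^2) := by
  have hq : (q : ℂ) ≠ 0 := by exact_mod_cast hq0.ne'
  have hqq : (q : ℂ) ^ 2 - 1 ≠ 0 := by
    have h : q ^ 2 - 1 ≠ 0 := by nlinarith
    exact_mod_cast h
  obtain ⟨p, rfl⟩ : ∃ p, n = p + 1 := ⟨n - 1, by omega⟩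
  have i1 : 2 * (p + 1) - (p + 1) = p + 1 := by omega
  have i2 : 2 * (p + 1) - p = p + 1 + 1 := by omega
  have i3 : 2 * (p + 1) - (p + 1 + 1) = p := by omega
  have i4 : 2 * (p + 1) + 1 - (p + 1) = p + 1 + 1 := by omega
  have i5 : p + 1 - 1 = p := by omega
  have bX := uKi_mul_uE (i := p + 1) (j := p + 1) (m := 2 * (p + 1)) hq
    (by omega) (by omega) (by omega) (by omega)
  have cX := uKi_mul_uE (i := p + 1 + 1) (j := p + 1) (m := 2 * (p + 1)) hq
    (by omega) (by omega) (by omega) (by omega)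
  have bZ := uKi_mul_uE (i := p + 1) (j := p + 1 + 1) (m := 2 * (p + 1)) hq
    (by omega) (by omega) (by omega) (by omega)
  have cZ := uKi_mul_uE (i := p + 1 + 1) (j := p + 1 + 1) (m := 2 * (p + 1)) hq
    (by omega) (by omega) (by omega) (by omega)
  have aY := uKi_mul_uF (i := p) (j := p + 1) (m := 2 * (p + 1)) hq
    (by omega) (by omega) (by omega) (by omega)
  have bY := uKi_mul_uF (i := p + 1) (j := p + 1) (m := 2 * (p + 1)) hq
    (by omega) (by omega) (by omega) (by omega)
  have cY := uKi_mul_uF (i := p + 1 + 1) (j := p + 1) (m := 2 * (p + 1)) hq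
    (by omega) (by omega) (by omega) (by omega)
  have aW := uKi_mul_uF (i := p) (j := p) (m := 2 * (p + 1)) hq
    (by omega) (by omega) (by omega) (by omega)
  have bW := uKi_mul_uF (i := p + 1) (j := p) (m := 2 * (p + 1)) hq
    (by omega) (by omega) (by omega) (by omega)
  have cW := uKi_mul_uF (i := p + 1 + 1) (j := p) (m := 2 * (p + 1)) hq
    (by omega) (by omega) (by omega) (by omega)
  have ZY := uE_mul_uF_of_ne (q := q) (i := p + 1 + 1) (j := p + 1) (m := 2 * (p + 1))
    (by omega) (by omega) (by omega) (by omega) (by omega)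
  have ZW := uE_mul_uF_of_ne (q := q) (i := p + 1 + 1) (j := p) (m := 2 * (p + 1))
    (by omega) (by omega) (by omega) (by omega) (by omega)
  have XW := uE_mul_uF_of_ne (q := q) (i := p + 1) (j := p) (m := 2 * (p + 1))
    (by omega) (by omega) (by omega) (by omega) (by omega)
  have XY := uE_mul_uF_self (q := q) (i := p + 1) (m := 2 * (p + 1)) (by omega) (by omega)
  have ba := uKi_mul_uKi (q := q) (m := 2 * (p + 1)) (p + 1) p
  have ca := uKi_mul_uKi (q := q) (m := 2 * (p + 1)) (p + 1 + 1) p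
  have cb := uKi_mul_uKi (q := q) (m := 2 * (p + 1)) (p + 1 + 1) (p + 1)
  have Kb := uK_mul_uKi (q := q) (m := 2 * (p + 1)) (p + 1)
  have Kc := uK_mul_uKi (q := q) (m := 2 * (p + 1)) (p + 1 + 1)
  have Kcb := (uKi_mul_uK_comm (q := q) (m := 2 * (p + 1)) (p + 1) (p + 1 + 1)).symm
  simp only [Enm1, Fnm1, En, Fn, Bs, xt, yt, Ccinv, i1, i2, i3, i4, i5]
  generalize uKi q (2 * (p + 1)) p = a at *
  generalize uKi q (2 * (p + 1)) (p + 1) = b at *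
  generalize uKi q (2 * (p + 1)) (p + 1 + 1) = c at *
  generalize uE q (2 * (p + 1)) (p + 1) = X at *
  generalize uE q (2 * (p + 1)) (p + 1 + 1) = Z at *
  generalize uF q (2 * (p + 1)) (p + 1) = Y at *
  generalize uF q (2 * (p + 1)) p = W at *
  generalize uK q (2 * (p + 1)) (p + 1) = Kn at *
  generalize uK q (2 * (p + 1)) (p + 1 + 1) = Kn1 at *
  have hpp : p ≠ p + 1 + 1 := by omega
  norm_num [kd, hpp, hpp.symm] at bX cX bZ cZ aY bY cY aW bW cW
  have bX' := mul_mul_eq_smul_of_mul_eq_smul bX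
  have cX' := mul_mul_eq_smul_of_mul_eq_smul cX
  have bZ' := mul_mul_eq_of_mul_eq bZ
  have cZ' := mul_mul_eq_smul_of_mul_eq_smul cZ
  have aY' := mul_mul_eq_of_mul_eq aY
  have bY' := mul_mul_eq_smul_of_mul_eq_smul bY
  have cY' := mul_mul_eq_smul_of_mul_eq_smul cY
  have aW' := mul_mul_eq_smul_of_mul_eq_smul aW
  have bW' := mul_mul_eq_smul_of_mul_eq_smul bW
  have cW' := mul_mul_eq_of_mul_eq cW
  have ZY' := mul_mul_eq_of_mul_eq ZY
  have ZW' := mul_mul_eq_of_mul_eq ZW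
  have XW' := mul_mul_eq_of_mul_eq XW
  have ba' := mul_mul_eq_of_mul_eq ba
  have ca' := mul_mul_eq_of_mul_eq ca
  have cb' := mul_mul_eq_of_mul_eq cb
  have Kb' (r : Uq q (2 * (p + 1))) : Kn * (b * r) = r := by rw [← mul_assoc, Kb, one_mul]
  have Kcb' := mul_mul_eq_of_mul_eq Kcb
  have XY' (r : Uq q (2 * (p + 1))) : X * (Y * r) = Y * (X * r) +
      ((q : ℂ) - (q : ℂ)⁻¹)⁻¹ • (Kn * (c * r) - b * (Kn1 * r)) := by
    simp only [← mul_assoc, XY, add_mul, sub_mul, smul_mul_assoc]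
  have zf : a * Z * c * (Y * c * b) = Y * c * b * (a * Z * c) := by
    simp only [mul_assoc, mul_smul_comm, cb, bZ', cZ', aY', cY', ZY', ba', ca', cb']
  have zw : a * Z * c * (W * b * c) = (q : ℂ) ^ 2 • (W * b * c * (a * Z * c)) := by
    simp only [pow_succ, pow_zero, one_mul, mul_assoc, mul_smul_comm, smul_smul, bZ', cZ', aW',
      cW', ZW', ba', ca', cb']
    match_scalars
    field_simp
  have we : W * b * c * (b * X * b) = (q : ℂ) ^ 2 • (b * X * b * (W * b * c)) := by
    simp only [pow_succ, pow_zero, one_mul, mul_assoc, smul_mul_assoc, mul_smul_comm, smul_smul,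
      bX, cb, bX', cX', bW', XW', cb']
    match_scalars
    field_simp
  have b2z : b ^ 2 * (a * Z * c) = a * Z * c * b ^ 2 := by
    simp only [pow_succ, pow_zero, one_mul, mul_assoc, cb, bZ', ba', cb']
  have b2w : b ^ 2 * (W * b * c) = ((q : ℂ) ^ 2)⁻¹ • (W * b * c * b ^ 2) := by
    simp only [pow_succ, pow_zero, one_mul, mul_assoc, mul_smul_comm, smul_smul, cb, bW', cb']
    match_scalars
    field_simp
  have Sw : (b * c) ^ 2 * (W * b * c) = ((q : ℂ) ^ 2)⁻¹ • (W * b * c * (b * c) ^ 2) := by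
    simp only [pow_succ, pow_zero, one_mul, mul_assoc, mul_smul_comm, smul_smul, bW', cW', cb']
    match_scalars
    field_simp
  have ef : b * X * b * (Y * c * b) - (q : ℂ) ^ 2 • (Y * c * b * (b * X * b)) =
      ((q : ℂ) ^ 2 / ((q : ℂ) ^ 2 - 1)) • ((b * c) ^ 2 - b ^ 4) := by
    simp only [pow_succ, pow_zero, one_mul, mul_assoc, smul_mul_assoc, mul_smul_comm, smul_smul,
      smul_sub, XY', Kb', Kc, Kcb', smul_add, mul_one, bX, cb, bX', cX', bY', cb']
    match_scalars <;> field_simp <;> ring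
  have Tz : ((q : ℂ) ^ 2 / ((q : ℂ) ^ 2 - 1)) • ((b * c) ^ 2 - b ^ 4) * (a * Z * c) -
      a * Z * c * (((q : ℂ) ^ 2 / ((q : ℂ) ^ 2 - 1)) • ((b * c) ^ 2 - b ^ 4)) =
        -(a * Z * c * (b * c) ^ 2) := by
    simp only [pow_succ, pow_zero, one_mul, mul_assoc, mul_sub, sub_mul, smul_mul_assoc,
      mul_smul_comm, smul_smul, smul_sub, cb, bZ', cZ', ba', ca', cb']
    match_scalars <;> field_simp <;> ring
  have ze : (q : ℂ) ^ (-2 : ℤ) = ((q : ℂ) ^ 2)⁻¹ := by rw [zpow_neg]; rfl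
  have bw : b * X * b * (W * b * c) = ((q : ℂ) ^ 2)⁻¹ • (W * b * c * (b * X * b)) := by
    rw [we, smul_smul, inv_mul_cancel₀ (pow_ne_zero 2 hq), one_smul]
  rw [ze]
  refine ⟨fun σ => ⟨?_, ?_⟩, zw, ?_, ?_, ?_⟩
  · rw [add_mul (_ + _), add_mul (Y * c * b), mul_add _ (_ + _), mul_add _ (Y * c * b),
      zf, smul_mul_assoc, mul_smul_comm, b2z]
    abel
  · rw [add_mul (_ + _), add_mul (Y * c * b), mul_add _ (_ + _), mul_add _ (Y * c * b),
      bw, smul_mul_assoc, mul_smul_comm, b2w]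
    module
  · generalize a * Z * c = z at *
    generalize W * b * c = w at *
    generalize Y * c * b = f at *
    have h1 : z * (f * w) = (q : ℂ) ^ 2 • (f * w * z) := by
      rw [← mul_assoc, zf, mul_assoc, zw, mul_smul_comm, mul_assoc]
    have h2 : z * (w * f) = (q : ℂ) ^ 2 • (w * f * z) := by
      rw [← mul_assoc, zw, smul_mul_assoc, mul_assoc, zf, mul_assoc]
    rw [mul_sub, mul_smul_comm, h1, h2, sub_mul, smul_mul_assoc]
    module
  · exact commutator_mul_comm_of_smul (pow_ne_zero 2 hq) zw we
  · exact commutator_mul_qCommutator hq zf zw we Sw (by rw [ef]; exact Tz)
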